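/- Corrective flips preserve the numbers of black stones, white stones, and pluses in a diagram: if D' is obtained from a •/◦/+-diagram D (stones colored black iff they are uncrossings) by performing a corrective flip, then D and D' contain the same number of black stones, the same number of white stones, and the same number of pluses. -/

import Mathlib

namespace GoPaper

/-- Fillings of a box: black stone, white stone, or plus. -/
inductive Fill : Type
  | black | white | plus
deriving DecidableEq

/-- A Ferrers shape inside the `k × (n-k)` rectangle (rows indexed from the top by
`0,…,k-1`, columns from the left by `0,…,n-k-1`), given by its set of boxes,
which is closed to the northwest. -/
structure Shape (n k : ℕ) where
  boxes : Finset (ℕ × ℕ)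
  row_lt : ∀ b ∈ boxes, b.1 < k
  col_lt : ∀ b ∈ boxes, b.2 < n - k
  nw_closed : ∀ b ∈ boxes, ∀ r c : ℕ, r ≤ b.1 → c ≤ b.2 → (r, c) ∈ boxes

/-- A `•/◦/+`-diagram: a Ferrers shape together with a filling of its boxes. -/
structure Diagram (n k : ℕ) where
  S : Shape n k
  fill : ℕ × ℕ → Fill

/-- `inIn b c` means `c ∈ b^in`, i.e. `c` is weakly to the right of and weakly below `b`. -/
def inIn (b c : ℕ × ℕ) : Prop := b.1 ≤ c.1 ∧ b.2 ≤ c.2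

instance (b c : ℕ × ℕ) : Decidable (inIn b c) := by unfold inIn; infer_instance

/-- The simple transposition `s_i` (0-indexed), as a permutation of `ℕ`. -/
def sw (i : ℕ) : Equiv.Perm ℕ := Equiv.swap i (i + 1)

/-- The (0-indexed) index of the simple transposition labelling box `b`:
the top-left box `(0,0)` is labelled `n-k-1`, indices decrease to the right and
increase downward. -/
def lab (n k : ℕ) (b : ℕ × ℕ) : ℕ := n - k - 1 + b.1 - b.2

/-- The simple transposition labelling box `b`. -/
def sbox (n k : ℕ) (b : ℕ × ℕ) : Equiv.Perm ℕ := sw (lab n k b)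

/-- Coxeter length of a permutation of `S_n` (supported on `{0,…,n-1}`): the
number of inversions. -/
def len (n : ℕ) (π : Equiv.Perm ℕ) : ℕ :=
  ((Finset.range n ×ˢ Finset.range n).filter (fun p => p.1 < p.2 ∧ π p.2 < π p.1)).card

/-- A canonical reading order on the boxes of a shape: rows from bottom to top,
each row from right to left (a valid reading order; all notions read off in a
reading order are independent of its choice). -/
def readingList {n k : ℕ} (S : Shape n k) : List (ℕ × ℕ) :=
  (((List.range k).reverse).flatMap fun r =>
      ((List.range (n - k)).reverse).map fun c => (r, c)).filter
    (fun b => decide (b ∈ S.boxes))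

/-- Product, in the reading order, of the box transpositions over boxes satisfying `p`. -/
def readProd {n k : ℕ} (D : Diagram n k) (p : ℕ × ℕ → Bool) : Equiv.Perm ℕ :=
  (((readingList D.S).filter p).map fun b => sbox n k b).prod

/-- The permutation `u` of the pipe dream of `D`: product of labels of the stone boxes. -/
def permU {n k : ℕ} (D : Diagram n k) : Equiv.Perm ℕ :=
  readProd D (fun b => decide (D.fill b ≠ Fill.plus))

/-- The Grassmannian permutation `v = v_λ`: product of labels of all boxes. -/
def permV {n k : ℕ} (D : Diagram n k) : Equiv.Perm ℕ := readProd D (fun _ => true)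

/-- `u_{b^in}^D`: product of the labels of the stone boxes of `b^in` other than `b`. -/
def uIn {n k : ℕ} (D : Diagram n k) (b : ℕ × ℕ) : Equiv.Perm ℕ :=
  readProd D (fun c => decide (inIn b c ∧ c ≠ b ∧ D.fill c ≠ Fill.plus))

/-- `v_{b^in}`: product of the labels of all boxes of `b^in`. -/
def vIn {n k : ℕ} (D : Diagram n k) (b : ℕ × ℕ) : Equiv.Perm ℕ :=
  readProd D (fun c => decide (inIn b c))

/-- `u_b^D`: the label of `b` if `b` contains a stone, the identity if it contains a plus. -/
def uBox {n k : ℕ} (D : Diagram n k) (b : ℕ × ℕ) : Equiv.Perm ℕ :=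
  if D.fill b = Fill.plus then 1 else sbox n k b

/-- The length-drop condition `ℓ(u_{b^in} u_b s_b) < ℓ(u_{b^in} u_b)` at box `b`. -/
def lenDrop {n k : ℕ} (D : Diagram n k) (b : ℕ × ℕ) : Prop :=
  len n (uIn D b * uBox D b * sbox n k b) < len n (uIn D b * uBox D b)

/-- `b` violates the distinguished property: the length drops at `b`, but `b` is
not filled with a black stone. -/
def ViolatesDist {n k : ℕ} (D : Diagram n k) (b : ℕ × ℕ) : Prop :=
  b ∈ D.S.boxes ∧ D.fill b ≠ Fill.black ∧ lenDrop D b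

/-- `D` is a Go-diagram: a box contains a black stone iff the length drops there. -/
def IsGoDiagram {n k : ℕ} (D : Diagram n k) : Prop :=
  ∀ b ∈ D.S.boxes, (D.fill b = Fill.black ↔ lenDrop D b)

/-- Number of boxes of `D` with filling `f`. -/
def countFill {n k : ℕ} (D : Diagram n k) (f : Fill) : ℕ :=
  (D.S.boxes.filter (fun b => D.fill b = f)).card

/-- Length of row `r` of the shape. -/
def rowLen {n k : ℕ} (S : Shape n k) (r : ℕ) : ℕ :=
  ((Finset.range (n - k)).filter (fun c => (r, c) ∈ S.boxes)).card

/-- The (0-indexed) label of the vertical boundary step in row `r`. -/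
def vlab {n k : ℕ} (S : Shape n k) (r : ℕ) : ℕ := r + (n - k) - rowLen S r

/-- The (0-indexed) label of the horizontal boundary step in column `c`. -/
def hlab {n k : ℕ} (S : Shape n k) (c : ℕ) : ℕ :=
  (n - k - 1 - c) + ((Finset.range k).filter (fun r => c < rowLen S r)).card

/-- Labels of the pipes of the pipe dream of `D`: `pipeAux D fuel true b` is the
label of the pipe entering box `b` from the bottom, `pipeAux D fuel false b` the
label of the pipe entering from the right (stones are crossing tiles, pluses are
elbow tiles; pipes enter from the southeast boundary). -/
def pipeAux {n k : ℕ} (D : Diagram n k) : ℕ → Bool → ℕ × ℕ → ℕ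
  | 0, _, _ => 0
  | fuel + 1, true, b =>
      if (b.1 + 1, b.2) ∈ D.S.boxes then
        (if D.fill (b.1 + 1, b.2) = Fill.plus then pipeAux D fuel false (b.1 + 1, b.2)
          else pipeAux D fuel true (b.1 + 1, b.2))
      else hlab D.S b.2
  | fuel + 1, false, b =>
      if (b.1, b.2 + 1) ∈ D.S.boxes then
        (if D.fill (b.1, b.2 + 1) = Fill.plus then pipeAux D fuel true (b.1, b.2 + 1)
          else pipeAux D fuel false (b.1, b.2 + 1))
      else vlab D.S b.1

/-- The label of the pipe entering box `b` from the bottom. -/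
def pipeB {n k : ℕ} (D : Diagram n k) (b : ℕ × ℕ) : ℕ := pipeAux D (n + 1) true b

/-- The label of the pipe entering box `b` from the right. -/
def pipeR {n k : ℕ} (D : Diagram n k) (b : ℕ × ℕ) : ℕ := pipeAux D (n + 1) false b

/-- `b` is a box of `D` containing a stone (black or white). -/
def IsStone {n k : ℕ} (D : Diagram n k) (b : ℕ × ℕ) : Prop :=
  b ∈ D.S.boxes ∧ D.fill b ≠ Fill.plus

/-- The (unordered) pair of pipes passing through box `b`. -/
def pipePair {n k : ℕ} (D : Diagram n k) (b : ℕ × ℕ) : Finset ℕ :=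
  {pipeB D b, pipeR D b}

/-- `b, c` form a crossing/uncrossing pair: the same two pipes cross at `b`
(the pipe entering from the bottom is larger), flow northwest, and next
uncross at `c`. -/
def CrossUncrossPair {n k : ℕ} (D : Diagram n k) (b c : ℕ × ℕ) : Prop :=
  IsStone D b ∧ IsStone D c ∧ b ≠ c ∧
  pipeR D b < pipeB D b ∧ pipeB D c < pipeR D c ∧
  pipePair D b = pipePair D c ∧ inIn c b ∧
  ∀ d : ℕ × ℕ, IsStone D d → pipePair D d = pipePair D b →
    inIn c d → inIn d b → d = b ∨ d = c

/-- Stones of `D` are colored black iff they are uncrossing tiles. -/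
def BlackIffUncross {n k : ℕ} (D : Diagram n k) : Prop :=
  ∀ b ∈ D.S.boxes, (D.fill b = Fill.black ↔ (D.fill b ≠ Fill.plus ∧ pipeB D b < pipeR D b))

/-- Change the filling of box `b` to `f`. -/
def setFill {n k : ℕ} (D : Diagram n k) (b : ℕ × ℕ) (f : Fill) : Diagram n k :=
  ⟨D.S, fun c => if c = b then f else D.fill c⟩

/-- Recolor the stones of `D` so that a stone is black iff it is an uncrossing. -/
def recolor {n k : ℕ} (D : Diagram n k) : Diagram n k :=
  ⟨D.S, fun b => if D.fill b = Fill.plus then Fill.plus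
    else if pipeB D b < pipeR D b then Fill.black else Fill.white⟩

/-- Equality of diagrams: same shape and the same filling on every box of the shape. -/
def DEq {n k : ℕ} (D D' : Diagram n k) : Prop :=
  D.S = D'.S ∧ ∀ b ∈ D.S.boxes, D.fill b = D'.fill b

/-- The diagram obtained by switching the plus at `p` with the stone at `t`, then
recoloring stones black iff they are uncrossings. -/
def flipPlusWith {n k : ℕ} (D : Diagram n k) (p t : ℕ × ℕ) : Diagram n k :=
  recolor (setFill (setFill D p Fill.white) t Fill.plus)

/-- `(p, t)` is a legal corrective-flip pair for `D`: `p` is a plus violating the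
distinguished property, and `t` is either the white stone `w` with which it violates
the distinguished property (i.e. placing a crossing at `p` makes `(w, p)` a
crossing/uncrossing pair), or `w`'s uncrossing partner, if it exists. -/
def IsFlipPair {n k : ℕ} (D : Diagram n k) (p t : ℕ × ℕ) : Prop :=
  p ∈ D.S.boxes ∧ D.fill p = Fill.plus ∧ lenDrop D p ∧
  ∃ w : ℕ × ℕ, CrossUncrossPair (setFill D p Fill.white) w p ∧
    (t = w ∨ CrossUncrossPair D w t)

/-- `D'` is obtained from `D` by performing a corrective flip. -/
def IsCorrectiveFlip {n k : ℕ} (D D' : Diagram n k) : Prop :=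
  ∃ p t : ℕ × ℕ, IsFlipPair D p t ∧ DEq D' (flipPlusWith D p t)

/-- Product of the simple transpositions along a word. -/
def wordProd (w : List ℕ) : Equiv.Perm ℕ := (w.map sw).prod

/-- Bruhat order on `S_n`: `u ≤ v` iff some reduced word for `u` is a subword of
some reduced word for `v`. -/
def BruhatLE (n : ℕ) (u v : Equiv.Perm ℕ) : Prop :=
  ∃ wv : List ℕ, (∀ i ∈ wv, i + 1 < n) ∧ wordProd wv = v ∧ wv.length = len n v ∧
    ∃ wu : List ℕ, wu.Sublist wv ∧ wordProd wu = u ∧ wu.length = len n u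

/-- Componentwise order on finite subsets of `ℕ`. -/
def FinsetLE (S T : Finset ℕ) : Prop :=
  List.Forall₂ (· ≤ ·) (S.sort (· ≤ ·)) (T.sort (· ≤ ·))

/-- Strict componentwise order on finite subsets of `ℕ`. -/
def FinsetLT (S T : Finset ℕ) : Prop := FinsetLE S T ∧ S ≠ T

/-- The (0-indexed) top set `{n-k, …, n-1}` (the set `{n-k+1, …, n}` of the paper). -/
def topSet (n k : ℕ) : Finset ℕ := (Finset.range n).filter (fun i => n - k ≤ i)

/-- The set `I_b = u_{b^in} u_b (v_{b^in})⁻¹ v {n, n-1, …, n-k+1}`. -/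
def Iset {n k : ℕ} (D : Diagram n k) (b : ℕ × ℕ) : Finset ℕ :=
  (topSet n k).image (fun x => (uIn D b * uBox D b * (vIn D b)⁻¹ * permV D) x)

/-- The set `J_b = u_{b^in} (v_{b^in})⁻¹ v {n, n-1, …, n-k+1}`. -/
def Jset {n k : ℕ} (D : Diagram n k) (b : ℕ × ℕ) : Finset ℕ :=
  (topSet n k).image (fun x => (uIn D b * (vIn D b)⁻¹ * permV D) x)

/-- `I_λ`: the set of labels of the vertical boundary steps of the shape. -/
def Ilam {n k : ℕ} (S : Shape n k) : Finset ℕ := (Finset.range k).image (fun r => vlab S r)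

/-- The Plücker coordinate of a `k × n` matrix at a `k`-subset `I ⊆ {0,…,n-1}`. -/
noncomputable def plucker {n k : ℕ} (A : Matrix (Fin k) (Fin n) ℝ) (I : Finset ℕ) : ℝ :=
  Matrix.det (Matrix.of fun i j : Fin k =>
    if h : (I.sort (· ≤ ·)).getD (j : ℕ) 0 < n then A i ⟨(I.sort (· ≤ ·)).getD (j : ℕ) 0, h⟩
    else 0)

/-- Full-rank `k × n` real matrices: representatives of points of `Gr(k,n)`. -/
def GrRep (k n : ℕ) : Type := {A : Matrix (Fin k) (Fin n) ℝ // A.rank = k}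

instance (k n : ℕ) : TopologicalSpace (GrRep k n) := by unfold GrRep; infer_instance

/-- Row equivalence of full-rank matrices. -/
def grSetoid (k n : ℕ) : Setoid (GrRep k n) where
  r A B := ∃ g : Matrix (Fin k) (Fin k) ℝ, IsUnit g.det ∧ B.1 = g * A.1
  iseqv := by
    refine ⟨fun A => ⟨1, ?_, ?_⟩, ?_, ?_⟩
    · simp
    · simp
    · rintro A B ⟨g, hg, hB⟩
      refine ⟨g⁻¹, Matrix.isUnit_nonsing_inv_det g hg, ?_⟩
      rw [hB, ← Matrix.mul_assoc, Matrix.nonsing_inv_mul g hg, Matrix.one_mul]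
    · rintro A B C ⟨g, hg, hB⟩ ⟨h, hh, hC⟩
      exact ⟨h * g, by rw [Matrix.det_mul]; exact hh.mul hg,
        by rw [hC, hB, Matrix.mul_assoc]⟩

/-- The Grassmannian `Gr(k,n)`, as the quotient of full-rank `k × n` matrices by
row equivalence, with the quotient topology. -/
def Gr (k n : ℕ) : Type := Quotient (grSetoid k n)

instance (k n : ℕ) : TopologicalSpace (Gr k n) := by
  unfold Gr; exact instTopologicalSpaceQuotient

/-- Matrix representatives of the Deodhar component indexed by a Go-diagram `D`:
`Δ_{I_b} = 0` for white-stone boxes, `Δ_{I_b} ≠ 0` for plus boxes, `Δ_{I_λ} ≠ 0`,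
and `Δ_S = 0` whenever `S ≱ I_λ`. -/
def deodharRep {n k : ℕ} (D : Diagram n k) : Set (Matrix (Fin k) (Fin n) ℝ) :=
  {A | (∀ b ∈ D.S.boxes, D.fill b = Fill.white → plucker A (Iset D b) = 0) ∧
      (∀ b ∈ D.S.boxes, D.fill b = Fill.plus → plucker A (Iset D b) ≠ 0) ∧
      plucker A (Ilam D.S) ≠ 0 ∧
      (∀ S : Finset ℕ, S ⊆ Finset.range n → S.card = k →
        ¬ FinsetLE (Ilam D.S) S → plucker A S = 0)}

/-- The Deodhar component in `Gr(k,n)` indexed by a Go-diagram `D`. -/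
def deodhar {n k : ℕ} (D : Diagram n k) : Set (Gr k n) :=
  {x | ∃ A : GrRep k n, Quotient.mk (grSetoid k n) A = x ∧ A.1 ∈ deodharRep D}

/-- The dimension of the Deodhar component indexed by `D` (by Deodhar's theorem,
the component is homeomorphic to `ℝ^{#black} × (ℝ \ {0})^{#plus}`). -/
def dimD {n k : ℕ} (D : Diagram n k) : ℕ :=
  countFill D Fill.black + countFill D Fill.plus

/-- The positroid cell of shape `S` and permutation `u`: the union of the Deodhar
components indexed by Go-diagrams of shape `S` with pipe-dream permutation `u`. -/
def positroid {n k : ℕ} (S : Shape n k) (u : Equiv.Perm ℕ) : Set (Gr k n) :=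
  {x | ∃ D : Diagram n k, D.S = S ∧ IsGoDiagram D ∧ permU D = u ∧ x ∈ deodhar D}

/-- A Le-diagram: no black stones, and no white stone with a plus above it in its
column and a plus to its left in its row. -/
def IsLeDiagram {n k : ℕ} (D : Diagram n k) : Prop :=
  (∀ b ∈ D.S.boxes, D.fill b ≠ Fill.black) ∧
  ∀ b ∈ D.S.boxes, D.fill b = Fill.white →
    ¬((∃ r : ℕ, r < b.1 ∧ D.fill (r, b.2) = Fill.plus) ∧
      (∃ c : ℕ, c < b.2 ∧ D.fill (b.1, c) = Fill.plus))

/-- A Le-move: on a rectangle with pluses in the top-left, top-right and bottom-left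
corners, a white stone in the bottom-right corner, and white stones elsewhere,
exchange the top-left plus with the bottom-right white stone. -/
def IsLeMove {n k : ℕ} (D D' : Diagram n k) : Prop :=
  D'.S = D.S ∧
  ∃ r1 r2 c1 c2 : ℕ, r1 < r2 ∧ c1 < c2 ∧ (r2, c2) ∈ D.S.boxes ∧
    D.fill (r1, c1) = Fill.plus ∧ D.fill (r1, c2) = Fill.plus ∧
    D.fill (r2, c1) = Fill.plus ∧ D.fill (r2, c2) = Fill.white ∧
    (∀ r c : ℕ, r1 ≤ r → r ≤ r2 → c1 ≤ c → c ≤ c2 →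
      ¬((r = r1 ∨ r = r2) ∧ (c = c1 ∨ c = c2)) → D.fill (r, c) = Fill.white) ∧
    D'.fill (r1, c1) = Fill.white ∧ D'.fill (r2, c2) = Fill.plus ∧
    (∀ b : ℕ × ℕ, b ≠ (r1, c1) → b ≠ (r2, c2) → D'.fill b = D.fill b)

/-- The first black stone or plus strictly to the right of `b` in its row. -/
def firstRight {n k : ℕ} (D : Diagram n k) (b : ℕ × ℕ) : Option (ℕ × ℕ) :=
  ((List.range (n - k)).map fun t => (b.1, b.2 + 1 + t)).find?
    (fun x => decide (x ∈ D.S.boxes ∧ D.fill x ≠ Fill.white))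

/-- The first black stone or plus strictly below `b` in its column. -/
def firstDown {n k : ℕ} (D : Diagram n k) (b : ℕ × ℕ) : Option (ℕ × ℕ) :=
  ((List.range k).map fun t => (b.1 + 1 + t, b.2)).find?
    (fun x => decide (x ∈ D.S.boxes ∧ D.fill x ≠ Fill.white))

/-- `x` is (relative to the oracle `pf`) the partner of some black stone of `b^in`
other than `b`. -/
noncomputable def partneredWhite {n k : ℕ} (D : Diagram n k) (pf : ℕ × ℕ → Option (ℕ × ℕ))
    (b x : ℕ × ℕ) : Bool :=
  D.S.boxes.toList.any fun d =>
    decide (inIn b d ∧ d ≠ b ∧ D.fill d = Fill.black ∧ pf d = some x)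

/-- Step 5 of the partner algorithm: the path from `b` travelling right
(`dir = true`) or down (`dir = false`), given an oracle `pf` of previously
assigned partners; turns at pluses, jumps at black stones to their partners,
and turns at white stones partnered with black stones of `b^in`. -/
noncomputable def pathAux {n k : ℕ} (D : Diagram n k) (pf : ℕ × ℕ → Option (ℕ × ℕ)) (b : ℕ × ℕ) :
    ℕ → Bool → ℕ × ℕ → List (ℕ × ℕ)
  | 0, _, _ => []
  | fuel + 1, dir, x =>
      let x' : ℕ × ℕ := if dir then (x.1, x.2 + 1) else (x.1 + 1, x.2)
      if x' ∈ D.S.boxes then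
        match D.fill x' with
        | Fill.plus => x' :: pathAux D pf b fuel (!dir) x'
        | Fill.black =>
            match pf x' with
            | some q => x' :: q :: pathAux D pf b fuel (!dir) q
            | none => [x']
        | Fill.white =>
            if partneredWhite D pf b x' then x' :: pathAux D pf b fuel (!dir) x'
            else x' :: pathAux D pf b fuel dir x'
      else []

/-- One step of the partner algorithm at box `b`, given an oracle `pf` of
previously assigned partners. Returns (partner of `b`, path `P_b`, path `Q_b`). -/
noncomputable def partnerCore {n k : ℕ} (D : Diagram n k) (pf : ℕ × ℕ → Option (ℕ × ℕ)) (b : ℕ × ℕ) :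
    Option (ℕ × ℕ) × List (ℕ × ℕ) × List (ℕ × ℕ) :=
  match firstRight D b, firstDown D b with
  | some c, some d =>
      let e : ℕ × ℕ := (d.1, c.2)
      if e ∈ D.S.boxes ∧
          (¬ ∃ i ∈ Finset.range d.1, b.1 < i ∧ (i, c.2) ∈ D.S.boxes ∧
            D.fill (i, c.2) ≠ Fill.white) ∧
          (¬ ∃ j ∈ Finset.range c.2, b.2 < j ∧ (d.1, j) ∈ D.S.boxes ∧
            D.fill (d.1, j) ≠ Fill.white) then
        if D.fill e = Fill.white then
          (some e,
            b :: (((List.range (c.2 - b.2)).map fun t => (b.1, b.2 + 1 + t)) ++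
              ((List.range (d.1 - b.1)).map fun t => (b.1 + 1 + t, c.2))),
            b :: (((List.range (d.1 - b.1)).map fun t => (b.1 + 1 + t, b.2)) ++
              ((List.range (c.2 - b.2)).map fun t => (d.1, b.2 + 1 + t))))
        else
          let P := b :: pathAux D pf b (n + 1) true b
          let Q := b :: pathAux D pf b (n + 1) false b
          let common := P.filter (fun m => decide (m ∈ Q))
          match common.find? (fun m => common.all fun m' => decide (inIn m m')) with
          | some m => (if D.fill m = Fill.white then some m else none, P, Q)
          | none => (none, P, Q)
      else (none, [], [])
  | _, _ => (none, [], [])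

/-- Iterated partner assignment (the recursion bottoms out along the partial
order `≼`, whose chains have length at most `n`). -/
noncomputable def partnerAux {n k : ℕ} (D : Diagram n k) : ℕ → ℕ × ℕ → Option (ℕ × ℕ)
  | 0, _ => none
  | m + 1, b => (partnerCore D (partnerAux D m) b).1

/-- The partner of box `b` in `D` (if any), per the recursive partner algorithm. -/
noncomputable def partner {n k : ℕ} (D : Diagram n k) (b : ℕ × ℕ) : Option (ℕ × ℕ) :=
  partnerAux D (n + 2) b

/-- The path `P_b` of the partner algorithm. -/
noncomputable def pathP {n k : ℕ} (D : Diagram n k) (b : ℕ × ℕ) : List (ℕ × ℕ) :=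
  (partnerCore D (partnerAux D (n + 1)) b).2.1

/-- The path `Q_b` of the partner algorithm. -/
noncomputable def pathQ {n k : ℕ} (D : Diagram n k) (b : ℕ × ℕ) : List (ℕ × ℕ) :=
  (partnerCore D (partnerAux D (n + 1)) b).2.2

/-- `f(D,b)`: replace with pluses all black stones in boxes `c ≺ b` and all white
stones that are partners of such boxes. -/
noncomputable def fDb {n k : ℕ} (D : Diagram n k) (b : ℕ × ℕ) : Diagram n k :=
  ⟨D.S, fun x =>
    if (D.fill x = Fill.black ∧ inIn b x ∧ x ≠ b) ∨
        (∃ c ∈ D.S.boxes, inIn b c ∧ c ≠ b ∧ D.fill c = Fill.black ∧ partner D c = some x)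
    then Fill.plus else D.fill x⟩

/-- Replace all black stones of `D`, and all of their partners, with pluses. -/
noncomputable def reduceGo {n k : ℕ} (D : Diagram n k) : Diagram n k :=
  ⟨D.S, fun x =>
    if D.fill x = Fill.black ∨
        (∃ c ∈ D.S.boxes, D.fill c = Fill.black ∧ partner D c = some x)
    then Fill.plus else D.fill x⟩

/-- Product, in a reading order, of the labels of the stone boxes of `b^in`. -/
def stonesProd {n k : ℕ} (D : Diagram n k) (b : ℕ × ℕ) : Equiv.Perm ℕ :=
  readProd D (fun c => decide (inIn b c ∧ D.fill c ≠ Fill.plus))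

/-- Property (P1) at `b`: the product of the labels of the stone boxes of `b^in`
is the same in `f(D,b)` as in `D`. -/
def P1 {n k : ℕ} (D : Diagram n k) (b : ℕ × ℕ) : Prop :=
  stonesProd (fDb D b) b = stonesProd D b

/-- Property (P2) at `b`: `b` has partner `p` iff `p` and `b` form a
crossing/uncrossing pair in the pipe dream of `f(D,b)`. -/
def P2 {n k : ℕ} (D : Diagram n k) (b : ℕ × ℕ) : Prop :=
  ∀ p : ℕ × ℕ, (partner D b = some p ↔ CrossUncrossPair (fDb D b) p b)

/-- `D` is a (nonempty) full `rows × cols` rectangle. -/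
def IsRectangle {n k : ℕ} (D : Diagram n k) (rows cols : ℕ) : Prop :=
  0 < rows ∧ 0 < cols ∧ D.S.boxes = Finset.range rows ×ˢ Finset.range cols

/-- A minimal violation: a rectangular diagram in which the only box violating the
distinguished property is the top-left corner, and the pair of pipes that should
uncross there initially cross in the bottom-right corner. -/
def IsMinimalViolation {n k : ℕ} (D : Diagram n k) (rows cols : ℕ) : Prop :=
  IsRectangle D rows cols ∧
  ViolatesDist D (0, 0) ∧
  (∀ b ∈ D.S.boxes, ViolatesDist D b → b = (0, 0)) ∧
  pipePair D (0, 0) = pipePair D (rows - 1, cols - 1) ∧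
  D.fill (rows - 1, cols - 1) ≠ Fill.plus ∧
  pipeR D (rows - 1, cols - 1) < pipeB D (rows - 1, cols - 1)

/-- The sequence `l` lists boxes of `S` without repetition, each one after all the boxes
weakly to its southeast. -/
def IsReading {n k : ℕ} (S : Shape n k) (l : List (ℕ × ℕ)) : Prop :=
  l.Nodup ∧ (∀ x ∈ l, x ∈ S.boxes) ∧
    ∀ l₁ b l₂, l = l₁ ++ b :: l₂ → ∀ c ∈ S.boxes, inIn b c → c ≠ b → c ∈ l₁

theorem IsReading.of_append {n k : ℕ} {S : Shape n k} {l m : List (ℕ × ℕ)}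
    (h : IsReading S (l ++ m)) : IsReading S l := by
  obtain ⟨h1, h2, h3⟩ := h
  refine ⟨(List.nodup_append.1 h1).1, fun x hx => h2 x (by simp [hx]), ?_⟩
  rintro l₁ b l₂ rfl
  exact h3 l₁ b (l₂ ++ m) (by simp)

theorem IsReading.closed {n k : ℕ} {S : Shape n k} {l : List (ℕ × ℕ)}
    (h : IsReading S l) {x c : ℕ × ℕ} (hx : x ∈ l) (hc : c ∈ S.boxes) (hxc : inIn x c) :
    c ∈ l := by
  by_cases hcx : c = x
  · exact hcx ▸ hx
  obtain ⟨l₁, l₂, rfl⟩ := List.append_of_mem hx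
  exact List.mem_append_left _ (h.2.2 l₁ x l₂ rfl c hc hxc hcx)

theorem IsReading.notMem {n k : ℕ} {S : Shape n k} {l m : List (ℕ × ℕ)} {b : ℕ × ℕ}
    (h : IsReading S (l ++ b :: m)) : b ∉ l := by
  intro hb
  exact (List.nodup_append.1 h.1).2.2 b hb b (by simp) rfl

theorem exists_isReading_of_le {n k : ℕ} (S : Shape n k) (m : ℕ) (hm : m ≤ S.boxes.card) :
    ∃ l, IsReading S l ∧ l.length = m := by
  induction m with
  | zero => exact ⟨[], ⟨by simp, by simp, by simp⟩, rfl⟩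
  | succ m ih =>
    obtain ⟨l, hl, hlen⟩ := ih (by omega)
    have hne : (S.boxes \ l.toFinset).Nonempty := by
      rw [← Finset.card_pos]
      have := Finset.le_card_sdiff l.toFinset S.boxes
      have := l.toFinset_card_le
      omega
    obtain ⟨b, hb, hmax⟩ := Finset.exists_max_image _ (fun x : ℕ × ℕ => x.1 + x.2) hne
    simp only [Finset.mem_sdiff, List.mem_toFinset] at hb hmax
    refine ⟨l ++ [b], ⟨?_, ?_, ?_⟩, by simp [hlen]⟩
    · refine List.nodup_append.2 ⟨hl.1, by simp, fun x hx y hy hxy => hb.2 ?_⟩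
      rwa [← List.mem_singleton.1 hy, ← hxy]
    · intro x hx
      rcases List.mem_append.1 hx with hx | hx
      · exact hl.2.1 x hx
      · rw [List.mem_singleton.1 hx]; exact hb.1
    · intro l₁ b' l₂ he c hc hin hcb
      rcases List.eq_nil_or_concat l₂ with rfl | ⟨l₃, y, rfl⟩
      · obtain ⟨rfl, hbb⟩ := List.append_inj' he rfl
        obtain rfl : b = b' := by simpa using hbb
        by_contra hcl
        have := hmax c ⟨hc, hcl⟩
        obtain ⟨h1, h2⟩ := hin
        exact hcb (Prod.ext (by omega) (by omega))
      · have he' : l ++ [b] = (l₁ ++ b' :: l₃) ++ [y] := by rw [he]; simp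
        obtain ⟨rfl, -⟩ := List.append_inj' he' rfl
        exact hl.2.2 l₁ b' l₃ rfl c hc hin hcb

theorem exists_isReading {n k : ℕ} (S : Shape n k) :
    ∃ l, IsReading S l ∧ l.toFinset = S.boxes := by
  obtain ⟨l, hl, hlen⟩ := exists_isReading_of_le S _ le_rfl
  refine ⟨l, hl, Finset.eq_of_subset_of_card_le (fun x hx => hl.2.1 x (by simpa using hx)) ?_⟩
  rw [List.toFinset_card_of_nodup hl.1, hlen]

/-- Product of the box permutations along a list of boxes. -/
def boxProd {n k : ℕ} (D : Diagram n k) (l : List (ℕ × ℕ)) : Equiv.Perm ℕ :=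
  (l.map (uBox D)).prod

theorem boxProd_append {n k : ℕ} (D : Diagram n k) (l m : List (ℕ × ℕ)) :
    boxProd D (l ++ m) = boxProd D l * boxProd D m := by
  simp [boxProd]

theorem boxProd_cons {n k : ℕ} (D : Diagram n k) (b : ℕ × ℕ) (m : List (ℕ × ℕ)) :
    boxProd D (b :: m) = uBox D b * boxProd D m := by
  simp [boxProd]

theorem boxProd_singleton {n k : ℕ} (D : Diagram n k) (b : ℕ × ℕ) :
    boxProd D [b] = uBox D b := by
  simp [boxProd]

theorem lt_rowLen_iff {n k : ℕ} (S : Shape n k) (r c : ℕ) :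
    c < rowLen S r ↔ (r, c) ∈ S.boxes := by
  constructor
  · intro h
    by_contra hc
    have : rowLen S r ≤ (Finset.range c).card := by
      refine Finset.card_le_card fun x hx => ?_
      simp only [Finset.mem_filter, Finset.mem_range] at hx ⊢
      by_contra hxc
      exact hc (S.nw_closed _ hx.2 r c le_rfl (by simpa using hxc))
    rw [Finset.card_range] at this
    omega
  · intro h
    have : (Finset.range (c + 1)).card ≤ rowLen S r := by
      refine Finset.card_le_card fun x hx => ?_
      simp only [Finset.mem_filter, Finset.mem_range] at hx ⊢
      have := S.col_lt _ h
      simp only at this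
      exact ⟨by omega, S.nw_closed _ h r x le_rfl (by simp; omega)⟩
    rw [Finset.card_range] at this
    omega

theorem vlab_eq_lab {n k : ℕ} (S : Shape n k) {b : ℕ × ℕ} (hb : b ∈ S.boxes)
    (h : (b.1, b.2 + 1) ∉ S.boxes) : vlab S b.1 = lab n k b := by
  have h1 := (lt_rowLen_iff S b.1 b.2).2 hb
  have h2 := mt (lt_rowLen_iff S b.1 (b.2 + 1)).1 h
  have h3 := S.col_lt _ hb
  unfold vlab lab
  omega

theorem hlab_eq_lab {n k : ℕ} (S : Shape n k) {b : ℕ × ℕ} (hb : b ∈ S.boxes)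
    (h : (b.1 + 1, b.2) ∉ S.boxes) : hlab S b.2 = lab n k b + 1 := by
  have : (Finset.range k).filter (fun r => b.2 < rowLen S r) = Finset.range (b.1 + 1) := by
    ext r
    simp only [Finset.mem_filter, Finset.mem_range, lt_rowLen_iff]
    constructor
    · rintro ⟨-, hr⟩
      by_contra hlt
      exact h (S.nw_closed _ hr _ _ (by simpa using hlt) le_rfl)
    · intro hr
      have := S.row_lt _ hb
      exact ⟨by omega, S.nw_closed _ hb _ _ (by omega) le_rfl⟩
  have h3 := S.col_lt _ hb
  unfold hlab lab
  rw [this, Finset.card_range]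
  omega

theorem box_sum_lt {n k : ℕ} (S : Shape n k) {b : ℕ × ℕ} (hb : b ∈ S.boxes) :
    b.1 + b.2 + 1 < n := by
  have := S.col_lt _ hb
  have := S.row_lt _ hb
  omega

theorem pipeAux_right {n k : ℕ} (D : Diagram n k) (m : ℕ) (b : ℕ × ℕ) :
    pipeAux D (m + 1) false b = if (b.1, b.2 + 1) ∈ D.S.boxes then
        (if D.fill (b.1, b.2 + 1) = Fill.plus then pipeAux D m true (b.1, b.2 + 1)
          else pipeAux D m false (b.1, b.2 + 1))
      else vlab D.S b.1 := rfl

theorem pipeAux_below {n k : ℕ} (D : Diagram n k) (m : ℕ) (b : ℕ × ℕ) :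
    pipeAux D (m + 1) true b = if (b.1 + 1, b.2) ∈ D.S.boxes then
        (if D.fill (b.1 + 1, b.2) = Fill.plus then pipeAux D m false (b.1 + 1, b.2)
          else pipeAux D m true (b.1 + 1, b.2))
      else hlab D.S b.2 := rfl

theorem pipeAux_succ {n k : ℕ} (D : Diagram n k) (m : ℕ) (d : Bool) (b : ℕ × ℕ)
    (hb : b ∈ D.S.boxes) (hm : n ≤ m + b.1 + b.2) :
    pipeAux D (m + 1) d b = pipeAux D m d b := by
  induction m generalizing d b with
  | zero => have := box_sum_lt D.S hb; omega
  | succ m ih =>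
    cases d
    · rw [pipeAux_right D (m + 1), pipeAux_right D m b]
      split_ifs with h1 h2
      · exact ih _ _ h1 (by simp; omega)
      · exact ih _ _ h1 (by simp; omega)
      · rfl
    · rw [pipeAux_below D (m + 1), pipeAux_below D m b]
      split_ifs with h1 h2
      · exact ih _ _ h1 (by simp; omega)
      · exact ih _ _ h1 (by simp; omega)
      · rfl

theorem pipeR_eq {n k : ℕ} (D : Diagram n k) (b : ℕ × ℕ) :
    pipeR D b = if (b.1, b.2 + 1) ∈ D.S.boxes then
        (if D.fill (b.1, b.2 + 1) = Fill.plus then pipeB D (b.1, b.2 + 1)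
          else pipeR D (b.1, b.2 + 1))
      else vlab D.S b.1 := by
  unfold pipeR pipeB
  rw [pipeAux_right D n b]
  split_ifs with h1 h2
  · exact (pipeAux_succ _ _ _ _ h1 (by simp; omega)).symm
  · exact (pipeAux_succ _ _ _ _ h1 (by simp; omega)).symm
  · rfl

theorem pipeB_eq {n k : ℕ} (D : Diagram n k) (b : ℕ × ℕ) :
    pipeB D b = if (b.1 + 1, b.2) ∈ D.S.boxes then
        (if D.fill (b.1 + 1, b.2) = Fill.plus then pipeR D (b.1 + 1, b.2)
          else pipeB D (b.1 + 1, b.2))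
      else hlab D.S b.2 := by
  unfold pipeR pipeB
  rw [pipeAux_below D n b]
  split_ifs with h1 h2
  · exact (pipeAux_succ _ _ _ _ h1 (by simp; omega)).symm
  · exact (pipeAux_succ _ _ _ _ h1 (by simp; omega)).symm
  · rfl

theorem uBox_apply_of_ne {n k : ℕ} (D : Diagram n k) (b : ℕ × ℕ) {i : ℕ}
    (h1 : i ≠ lab n k b) (h2 : i ≠ lab n k b + 1) : uBox D b i = i := by
  unfold uBox sbox sw
  split_ifs
  · rfl
  · exact Equiv.swap_apply_of_ne_of_ne h1 h2

/-- The pipes entering a box can be read off from the product of the boxes before it. -/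
theorem boxProd_apply {n k : ℕ} (D : Diagram n k) (l : List (ℕ × ℕ)) (hl : IsReading D.S l)
    (b : ℕ × ℕ) (hb : b ∈ D.S.boxes) (hbl : b ∉ l) :
    (((b.1, b.2 + 1) ∈ D.S.boxes → (b.1, b.2 + 1) ∈ l) →
      boxProd D l (lab n k b) = pipeR D b) ∧
    (((b.1 + 1, b.2) ∈ D.S.boxes → (b.1 + 1, b.2) ∈ l) →
      boxProd D l (lab n k b + 1) = pipeB D b) := by
  induction l using List.reverseRecOn generalizing b with
  | nil =>
    constructor
    · intro h
      have h' : (b.1, b.2 + 1) ∉ D.S.boxes := fun hh => by simpa using h hh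
      rw [pipeR_eq, if_neg h', vlab_eq_lab D.S hb h']; rfl
    · intro h
      have h' : (b.1 + 1, b.2) ∉ D.S.boxes := fun hh => by simpa using h hh
      rw [pipeB_eq, if_neg h', hlab_eq_lab D.S hb h']; rfl
  | append_singleton l a ih =>
    have hl' := hl.of_append
    have haS : a ∈ D.S.boxes := hl.2.1 a (by simp)
    have hal : a ∉ l := hl.notMem
    have hcl : ∀ c ∈ D.S.boxes, inIn a c → c ≠ a → c ∈ l := hl.2.2 l a [] rfl
    have hbl' : b ∉ l := fun h => hbl (by simp [h])
    have hba : b ≠ a := fun h => hbl (by simp [h])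
    have hnin : ¬ inIn a b := fun h => hbl' (hcl b hb h hba)
    obtain ⟨ihaR, ihaB⟩ := ih hl' a haS hal
    have haR := ihaR fun h => hcl _ h ⟨le_rfl, Nat.le_succ _⟩
      (fun h => by have := congrArg Prod.snd h; simp at this)
    have haB := ihaB fun h => hcl _ h ⟨Nat.le_succ _, le_rfl⟩
      (fun h => by have := congrArg Prod.fst h; simp at this)
    obtain ⟨ihR, ihB⟩ := ih hl' b hb hbl'
    have hca := D.S.col_lt _ haS
    have hcb := D.S.col_lt _ hb
    have hlabs : ∀ x : ℕ × ℕ, lab n k x = n - k - 1 + x.1 - x.2 := fun _ => rfl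
    have hnin' : ¬ (a.1 ≤ b.1 ∧ a.2 ≤ b.2) := hnin
    rw [boxProd_append, boxProd_singleton]
    simp only [Equiv.Perm.mul_apply]
    constructor
    · intro h
      by_cases hR : (b.1, b.2 + 1) = a
      · have hlab : lab n k b = lab n k a + 1 := by
          rw [hlabs, hlabs, ← hR]; simp only; rw [← hR] at hca; simp only at hca; omega
        rw [pipeR_eq, hR, if_pos haS, hlab]
        unfold uBox sbox sw
        split_ifs with hf
        · exact haB
        · rw [Equiv.swap_apply_right]; exact haR
      · have h' : (b.1, b.2 + 1) ∈ D.S.boxes → (b.1, b.2 + 1) ∈ l := fun hh => by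
          have := h hh
          rw [List.mem_append, List.mem_singleton] at this
          exact this.resolve_right hR
        have hno : ¬ (b.1 ≤ a.1 ∧ b.2 + 1 ≤ a.2) := fun ⟨h1, h2⟩ =>
          hal (hl'.closed (h' (D.S.nw_closed _ haS _ _ h1 h2)) haS ⟨h1, h2⟩)
        rw [uBox_apply_of_ne, ihR h']
        · intro he; rw [hlabs, hlabs] at he
          have : ¬ (a.1 = b.1 ∧ a.2 = b.2) := fun hh => hba (Prod.ext hh.1.symm hh.2.symm)
          omega
        · intro he; rw [hlabs, hlabs] at he; omega
    · intro h
      by_cases hR : (b.1 + 1, b.2) = a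
      · have hlab : lab n k b + 1 = lab n k a := by
          rw [hlabs, hlabs, ← hR]; simp only; omega
        rw [pipeB_eq, hR, if_pos haS, hlab]
        unfold uBox sbox sw
        split_ifs with hf
        · exact haR
        · rw [Equiv.swap_apply_left]; exact haB
      · have h' : (b.1 + 1, b.2) ∈ D.S.boxes → (b.1 + 1, b.2) ∈ l := fun hh => by
          have := h hh
          rw [List.mem_append, List.mem_singleton] at this
          exact this.resolve_right hR
        have hno : ¬ (b.1 + 1 ≤ a.1 ∧ b.2 ≤ a.2) := fun ⟨h1, h2⟩ =>
          hal (hl'.closed (h' (D.S.nw_closed _ haS _ _ h1 h2)) haS ⟨h1, h2⟩)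
        rw [uBox_apply_of_ne, ihB h']
        · intro he; rw [hlabs, hlabs] at he; omega
        · intro he; rw [hlabs, hlabs] at he
          have : ¬ (a.1 = b.1 ∧ a.2 = b.2) := fun hh => hba (Prod.ext hh.1.symm hh.2.symm)
          omega

theorem boxProd_apply_next {n k : ℕ} (D : Diagram n k) (l m : List (ℕ × ℕ)) (b : ℕ × ℕ)
    (hl : IsReading D.S (l ++ b :: m)) :
    boxProd D l (lab n k b) = pipeR D b ∧ boxProd D l (lab n k b + 1) = pipeB D b := by
  have hcl := hl.2.2 l b m rfl
  obtain ⟨h1, h2⟩ := boxProd_apply D l hl.of_append b (hl.2.1 b (by simp)) hl.notMem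
  exact ⟨h1 fun h => hcl _ h ⟨le_rfl, Nat.le_succ _⟩
      (fun h => by have := congrArg Prod.snd h; simp at this),
    h2 fun h => hcl _ h ⟨Nat.le_succ _, le_rfl⟩
      (fun h => by have := congrArg Prod.fst h; simp at this)⟩

theorem len_mul_sw_of_lt {n : ℕ} (π : Equiv.Perm ℕ) {i : ℕ} (hi : i + 1 < n)
    (h : π i < π (i + 1)) : len n (π * sw i) = len n π + 1 := by
  have key : ∀ x, sw i x = if x = i then i + 1 else if x = i + 1 then i else x := fun x => by
    unfold sw; rw [Equiv.swap_apply_def]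
  unfold len
  set A := (Finset.range n ×ˢ Finset.range n).filter
    (fun p => p.1 < p.2 ∧ π p.2 < π p.1) with hA
  set B := (Finset.range n ×ˢ Finset.range n).filter
    (fun p => p.1 < p.2 ∧ (π * sw i) p.2 < (π * sw i) p.1) with hB
  have memA : ∀ x y, (x, y) ∈ A ↔ (x < n ∧ y < n) ∧ x < y ∧ π y < π x := fun x y => by
    rw [hA, Finset.mem_filter, Finset.mem_product, Finset.mem_range, Finset.mem_range]
  have memB : ∀ x y, (x, y) ∈ B ↔ (x < n ∧ y < n) ∧ x < y ∧ π (sw i y) < π (sw i x) :=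
    fun x y => by
      rw [hB, Finset.mem_filter, Finset.mem_product, Finset.mem_range, Finset.mem_range]; rfl
  have hmem : (i, i + 1) ∈ B := by
    rw [memB]
    refine ⟨⟨by omega, hi⟩, by omega, ?_⟩
    simpa [sw] using h
  have hinv : ∀ x, sw i (sw i x) = x := fun x => by unfold sw; simp
  rw [← Finset.card_erase_add_one hmem]
  congr 1
  refine Finset.card_bij' (fun p _ => (sw i p.1, sw i p.2)) (fun p _ => (sw i p.1, sw i p.2))
    ?_ ?_ (fun p _ => by simp [hinv]) (fun p _ => by simp [hinv])
  · rintro ⟨x, y⟩ hp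
    rw [Finset.mem_erase, memB, ne_eq, Prod.mk.injEq] at hp
    rw [memA]
    refine ⟨?_, ?_, hp.2.2.2⟩
    · rw [key, key]; split_ifs <;> omega
    · rw [key, key]; split_ifs <;> omega
  · rintro ⟨x, y⟩ hp
    rw [memA] at hp
    have hne : ¬ (x = i ∧ y = i + 1) := by rintro ⟨rfl, rfl⟩; omega
    rw [Finset.mem_erase, memB, ne_eq, Prod.mk.injEq, hinv, hinv]
    refine ⟨?_, ?_, ?_, hp.2.2⟩
    · rw [key, key]; split_ifs <;> omega
    · rw [key, key]; split_ifs <;> omega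
    · rw [key, key]; split_ifs <;> omega

theorem len_mul_sw_of_gt {n : ℕ} (π : Equiv.Perm ℕ) {i : ℕ} (hi : i + 1 < n)
    (h : π (i + 1) < π i) : len n (π * sw i) + 1 = len n π := by
  have := len_mul_sw_of_lt (π * sw i) hi (by simpa [sw] using h)
  rw [← this, mul_assoc]
  simp [sw]

/-- The length of the pipe dream permutation is the number of crossings minus
the number of uncrossings. -/
theorem len_boxProd {n k : ℕ} (D : Diagram n k) (l : List (ℕ × ℕ)) (hl : IsReading D.S l) :
    len n (boxProd D l) + 2 * l.countP (fun b => D.fill b ≠ Fill.plus ∧ pipeB D b < pipeR D b) =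
      l.countP (fun b => D.fill b ≠ Fill.plus) := by
  induction l using List.reverseRecOn with
  | nil =>
    simp only [boxProd, List.map_nil, List.prod_nil, List.countP_nil, len, Equiv.Perm.one_apply]
    rw [Finset.card_eq_zero.2]
    rw [Finset.filter_eq_empty_iff]
    intro p _
    omega
  | append_singleton l b ih =>
    have ih := ih hl.of_append
    obtain ⟨hR, hB⟩ := boxProd_apply_next D l [] b hl
    have hbS : b ∈ D.S.boxes := hl.2.1 b (by simp)
    have hlab : lab n k b + 1 < n := by
      have := D.S.col_lt _ hbS
      have := D.S.row_lt _ hbS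
      unfold lab; omega
    have hne : pipeR D b ≠ pipeB D b := by
      rw [← hR, ← hB]; intro h; have := (boxProd D l).injective h; omega
    rw [boxProd_append, boxProd_singleton]
    by_cases hf : D.fill b = Fill.plus
    · simp only [List.countP_append, uBox, hf, List.countP_singleton]
      simpa using ih
    · have hu : uBox D b = sw (lab n k b) := by simp [uBox, hf, sbox]
      rw [hu]
      simp only [List.countP_append, List.countP_singleton]
      rcases lt_or_gt_of_ne hne with h | h
      · rw [len_mul_sw_of_lt _ hlab (by rw [hR, hB]; exact h)]
        have : ¬ pipeB D b < pipeR D b := by omega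
        rw [if_neg (by simp [this]), if_pos (by simp [hf])]
        omega
      · have h2 := len_mul_sw_of_gt (n := n) (boxProd D l) hlab (by rw [hR, hB]; exact h)
        rw [if_pos (by simp [hf, h]), if_pos (by simp [hf])]
        omega

theorem boxProd_congr {n k : ℕ} {D E : Diagram n k} {l : List (ℕ × ℕ)}
    (h : ∀ b ∈ l, D.fill b = E.fill b) : boxProd D l = boxProd E l := by
  unfold boxProd
  congr 1
  refine List.map_congr_left fun b hb => ?_
  simp [uBox, h b hb]

theorem sw_conj_of_pair_eq (A M : Equiv.Perm ℕ) (i j : ℕ)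
    (h : ({A (i + 1), A i} : Finset ℕ) = {(A * M) (j + 1), (A * M) j}) :
    sw i * M = M * sw j := by
  have h1 : Equiv.swap (A i) (A (i + 1)) = Equiv.swap ((A * M) j) ((A * M) (j + 1)) := by
    have hne : A i ≠ A (i + 1) := fun h => by have := A.injective h; omega
    have m1 : A i ∈ ({(A * M) (j + 1), (A * M) j} : Finset ℕ) := by rw [← h]; simp
    have m2 : A (i + 1) ∈ ({(A * M) (j + 1), (A * M) j} : Finset ℕ) := by rw [← h]; simp
    simp only [Finset.mem_insert, Finset.mem_singleton] at m1 m2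
    rcases m1 with m1 | m1 <;> rcases m2 with m2 | m2
    · exact absurd (m1.trans m2.symm) hne
    · rw [m1, m2, Equiv.swap_comm]
    · rw [m1, m2]
    · exact absurd (m1.trans m2.symm) hne
  rw [Equiv.swap_apply_apply, Equiv.swap_apply_apply] at h1
  have h2 : A * (sw i) * A⁻¹ = A * (M * sw j * M⁻¹) * A⁻¹ := by
    unfold sw; rw [h1]; group
  have h3 := mul_left_cancel (mul_right_cancel h2)
  rw [h3]; group

theorem sw_mul_self (i : ℕ) : sw i * sw i = 1 := by simp [sw]

/-- Exchanging a stone and a plus through which the same two pipes pass does not change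
the permutation of the pipe dream. -/
theorem boxProd_exchange {n k : ℕ} {D E : Diagram n k} {l₁ l₂ l₃ : List (ℕ × ℕ)}
    {a b : ℕ × ℕ} (hl : IsReading D.S (l₁ ++ a :: (l₂ ++ b :: l₃)))
    (hpair : pipePair D a = pipePair D b)
    (hDE : ∀ c, c ≠ a → c ≠ b → D.fill c = E.fill c)
    (h : (D.fill a = Fill.plus ∧ D.fill b ≠ Fill.plus ∧
        E.fill a ≠ Fill.plus ∧ E.fill b = Fill.plus) ∨
      (D.fill a ≠ Fill.plus ∧ D.fill b = Fill.plus ∧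
        E.fill a = Fill.plus ∧ E.fill b ≠ Fill.plus)) :
    boxProd D (l₁ ++ a :: (l₂ ++ b :: l₃)) = boxProd E (l₁ ++ a :: (l₂ ++ b :: l₃)) := by
  have hnd := hl.1
  simp only [List.nodup_append, List.nodup_cons, List.mem_append, List.mem_cons, not_or] at hnd
  have e1 : boxProd D l₁ = boxProd E l₁ := boxProd_congr fun c hc => hDE c
    (by rintro rfl; exact hnd.2.2 c hc c (by simp) rfl)
    (by rintro rfl; exact hnd.2.2 c hc c (by simp) rfl)
  have e2 : boxProd D l₂ = boxProd E l₂ := boxProd_congr fun c hc => hDE c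
    (by rintro rfl; exact hnd.2.1.1.1 hc)
    (by rintro rfl; exact hnd.2.1.2.2.2 c hc c (by simp) rfl)
  have e3 : boxProd D l₃ = boxProd E l₃ := boxProd_congr fun c hc => hDE c
    (by rintro rfl; exact hnd.2.1.1.2.2 hc)
    (by rintro rfl; exact hnd.2.1.2.2.1.1 hc)
  obtain ⟨hRa, hBa⟩ := boxProd_apply_next D l₁ _ a hl
  obtain ⟨hRb, hBb⟩ := boxProd_apply_next D (l₁ ++ a :: l₂) l₃ b (by simpa using hl)
  unfold pipePair at hpair
  rw [← hRa, ← hBa, ← hRb, ← hBb, boxProd_append, boxProd_cons] at hpair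
  have hc := sw_conj_of_pair_eq _ _ _ _ hpair
  simp only [boxProd_append, boxProd_cons, ← e1, ← e2, ← e3]
  rcases h with ⟨h1, h2, h3, h4⟩ | ⟨h1, h2, h3, h4⟩
  · simp only [uBox, h1, h2, h3, h4, if_true, if_false, sbox, one_mul] at hc ⊢
    rw [← mul_assoc (sw (lab n k a)) (boxProd D l₂), hc, mul_assoc]
  · simp only [uBox, h1, h2, h3, h4, if_true, if_false, sbox, one_mul] at hc ⊢
    have hc' : sw (lab n k a) * boxProd D l₂ = boxProd D l₂ * sw (lab n k b) := by
      rw [← mul_assoc, sw_mul_self, one_mul] at hc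
      conv_rhs => rw [hc]
      rw [mul_assoc, sw_mul_self, mul_one]
    rw [← mul_assoc (sw (lab n k a)) (boxProd D l₂), hc', mul_assoc]

theorem pipeAux_setFill {n k : ℕ} (D : Diagram n k) (p : ℕ × ℕ) (f : Fill) (m : ℕ) (d : Bool)
    (b : ℕ × ℕ) (h : inIn p b) : pipeAux (setFill D p f) m d b = pipeAux D m d b := by
  induction m generalizing d b with
  | zero => rfl
  | succ m ih =>
    obtain ⟨h1, h2⟩ := h
    have hr : (b.1, b.2 + 1) ≠ p := by rintro rfl; simp at h2
    have hb : (b.1 + 1, b.2) ≠ p := by rintro rfl; simp at h1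
    have ihr := fun d => ih d (b.1, b.2 + 1) ⟨h1, by simp; omega⟩
    have ihb := fun d => ih d (b.1 + 1, b.2) ⟨by simp; omega, h2⟩
    cases d
    · rw [pipeAux, pipeAux, ihr, ihr]; simp [setFill, hr]
    · rw [pipeAux, pipeAux, ihb, ihb]; simp [setFill, hb]

theorem pipePair_setFill {n k : ℕ} (D : Diagram n k) (p : ℕ × ℕ) (f : Fill)
    (b : ℕ × ℕ) (h : inIn p b) : pipePair (setFill D p f) b = pipePair D b := by
  unfold pipePair pipeB pipeR
  rw [pipeAux_setFill _ _ _ _ _ _ h, pipeAux_setFill _ _ _ _ _ _ h]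

theorem IsFlipPair.stone_and_pair {n k : ℕ} {D : Diagram n k} {p t : ℕ × ℕ}
    (h : IsFlipPair D p t) :
    t ∈ D.S.boxes ∧ D.fill t ≠ Fill.plus ∧ pipePair D p = pipePair D t := by
  obtain ⟨-, -, -, w, ⟨hw, -, hwp, -, -, hpair, hin, -⟩, ht⟩ := h
  rw [pipePair_setFill _ _ _ _ hin, pipePair_setFill _ _ _ _ ⟨le_rfl, le_rfl⟩] at hpair
  rcases ht with rfl | ⟨-, ht, -, -, -, hpair', -⟩
  · exact ⟨hw.1, by simpa [setFill, hwp] using hw.2, hpair.symm⟩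
  · exact ⟨ht.1, ht.2, hpair.symm.trans hpair'⟩

/-- The number of uncrossings of a diagram. -/
def uncrossCount {n k : ℕ} (D : Diagram n k) : ℕ :=
  (D.S.boxes.filter fun b => D.fill b ≠ Fill.plus ∧ pipeB D b < pipeR D b).card

/-- The number of stones of a diagram. -/
def stoneCount {n k : ℕ} (D : Diagram n k) : ℕ :=
  (D.S.boxes.filter fun b => D.fill b ≠ Fill.plus).card

theorem countP_eq_card {l : List (ℕ × ℕ)} {s : Finset (ℕ × ℕ)} (hl : l.Nodup)
    (hs : l.toFinset = s) (q : ℕ × ℕ → Prop) [DecidablePred q] :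
    l.countP (fun b => q b) = (s.filter q).card := by
  subst hs
  rw [List.countP_eq_length_filter, ← List.toFinset_card_of_nodup (hl.filter _),
    List.toFinset_filter]
  simp

theorem stoneCount_eq_black_add_white {n k : ℕ} (D : Diagram n k) :
    stoneCount D = countFill D Fill.black + countFill D Fill.white := by
  unfold stoneCount countFill
  rw [← Finset.card_union_of_disjoint]
  · congr 1
    ext b
    simp only [Finset.mem_filter, Finset.mem_union]
    cases D.fill b <;> simp
  · rw [Finset.disjoint_filter]
    intro b _ h1 h2
    rw [h1] at h2
    cases h2

theorem stoneCount_add_plus {n k : ℕ} (D : Diagram n k) :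
    stoneCount D + countFill D Fill.plus = D.S.boxes.card := by
  unfold stoneCount countFill
  rw [add_comm, Finset.card_filter_add_card_filter_not]

theorem stoneCount_flip {n k : ℕ} {D E : Diagram n k} {p t : ℕ × ℕ} (hS : D.S = E.S)
    (hp : p ∈ D.S.boxes) (ht : t ∈ D.S.boxes)
    (h : ∀ c, c ≠ p → c ≠ t → D.fill c = E.fill c)
    (h1 : D.fill p = Fill.plus) (h2 : D.fill t ≠ Fill.plus)
    (h3 : E.fill p ≠ Fill.plus) (h4 : E.fill t = Fill.plus) :
    stoneCount D = stoneCount E := by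
  unfold stoneCount
  rw [← hS]
  have mem_swap : ∀ x ∈ D.S.boxes, Equiv.swap p t x ∈ D.S.boxes := fun x hx => by
    rw [Equiv.swap_apply_def]; split_ifs <;> assumption
  have fill_swap : ∀ x, D.fill x ≠ Fill.plus ↔ E.fill (Equiv.swap p t x) ≠ Fill.plus := fun x => by
    rw [Equiv.swap_apply_def]
    split_ifs with hx hx'
    · subst hx; simp [h1, h4]
    · subst hx'; simp [h2, h3]
    · rw [h x hx hx']
  refine Finset.card_bij' (fun x _ => Equiv.swap p t x) (fun x _ => Equiv.swap p t x)
    ?_ ?_ (fun x _ => by simp) (fun x _ => by simp)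
  · intro x hx
    rw [Finset.mem_filter] at hx ⊢
    exact ⟨mem_swap x hx.1, (fill_swap x).1 hx.2⟩
  · intro x hx
    rw [Finset.mem_filter] at hx ⊢
    exact ⟨mem_swap x hx.1, (fill_swap _).2 (by simpa using hx.2)⟩

theorem uncrossCount_flip {n k : ℕ} {D E : Diagram n k} {p t : ℕ × ℕ} (hS : D.S = E.S)
    (hp : p ∈ D.S.boxes) (ht : t ∈ D.S.boxes)
    (h : ∀ c, c ≠ p → c ≠ t → D.fill c = E.fill c)
    (h1 : D.fill p = Fill.plus) (h2 : D.fill t ≠ Fill.plus)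
    (h3 : E.fill p ≠ Fill.plus) (h4 : E.fill t = Fill.plus)
    (hpair : pipePair D p = pipePair D t) :
    uncrossCount D = uncrossCount E := by
  obtain ⟨l, hl, hlS⟩ := exists_isReading D.S
  have hst := stoneCount_flip hS hp ht h h1 h2 h3 h4
  have hpt : p ≠ t := by rintro rfl; exact h2 h1
  have hprod : boxProd D l = boxProd E l := by
    obtain ⟨l₁, m, rfl⟩ := List.append_of_mem (List.mem_toFinset.1 (hlS ▸ hp))
    have htl : t ∈ l₁ ++ p :: m := List.mem_toFinset.1 (hlS ▸ ht)
    simp only [List.mem_append, List.mem_cons, hpt.symm, false_or] at htl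
    rcases htl with htl | htl
    · obtain ⟨l₂, l₃, rfl⟩ := List.append_of_mem htl
      simp only [List.append_assoc, List.cons_append] at hl ⊢
      exact boxProd_exchange hl hpair.symm (fun c hc hc' => h c hc' hc)
        (Or.inr ⟨h2, h1, h4, h3⟩)
    · obtain ⟨l₂, l₃, rfl⟩ := List.append_of_mem htl
      exact boxProd_exchange hl hpair h (Or.inl ⟨h1, h2, h3, h4⟩)
  have c1 := len_boxProd D l hl
  have c2 := len_boxProd E l (hS ▸ hl)
  rw [countP_eq_card hl.1 hlS, countP_eq_card hl.1 hlS] at c1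
  rw [countP_eq_card hl.1 (hlS.trans (by rw [hS])),
    countP_eq_card hl.1 (hlS.trans (by rw [hS]))] at c2
  unfold stoneCount at hst
  unfold uncrossCount
  rw [hprod] at c1
  omega

theorem countFill_congr {n k : ℕ} {D E : Diagram n k} (h : DEq D E) (f : Fill) :
    countFill D f = countFill E f := by
  unfold countFill
  rw [← h.1]
  congr 1
  refine Finset.filter_congr fun b hb => ?_
  rw [h.2 b hb]

theorem countFill_black_of_blackIffUncross {n k : ℕ} {D : Diagram n k}
    (hB : BlackIffUncross D) : countFill D Fill.black = uncrossCount D := by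
  unfold countFill uncrossCount
  congr 1
  exact Finset.filter_congr hB

theorem countFill_black_recolor {n k : ℕ} (D : Diagram n k) :
    countFill (recolor D) Fill.black = uncrossCount D := by
  unfold countFill uncrossCount
  congr 1
  refine Finset.filter_congr fun b _ => ?_
  by_cases h1 : D.fill b = Fill.plus <;> by_cases h2 : pipeB D b < pipeR D b <;>
    simp [recolor, h1, h2]

theorem stoneCount_recolor {n k : ℕ} (D : Diagram n k) :
    stoneCount (recolor D) = stoneCount D := by
  unfold stoneCount
  congr 1
  refine Finset.filter_congr fun b _ => ?_
  by_cases h1 : D.fill b = Fill.plus <;> by_cases h2 : pipeB D b < pipeR D b <;>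
    simp [recolor, h1, h2]

/-- Corrective flips preserve the numbers of black stones, white
stones, and pluses. -/
theorem corrective_flip_preserves_counts {n k : ℕ} (D D' : Diagram n k)
    (hB : BlackIffUncross D) (h : IsCorrectiveFlip D D') :
    countFill D Fill.black = countFill D' Fill.black ∧
    countFill D Fill.white = countFill D' Fill.white ∧
    countFill D Fill.plus = countFill D' Fill.plus := by
  obtain ⟨p, t, hflip, hD'⟩ := h
  obtain ⟨ht, htf, hpair⟩ := hflip.stone_and_pair
  obtain ⟨hp, hpf, -⟩ := hflip
  have hpt : p ≠ t := by rintro rfl; exact htf hpf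
  set E := setFill (setFill D p Fill.white) t Fill.plus with hE
  have hfill : ∀ c, c ≠ p → c ≠ t → D.fill c = E.fill c := fun c h1 h2 => by
    simp [hE, setFill, h1, h2]
  have hEp : E.fill p ≠ Fill.plus := by simp [hE, setFill, hpt]
  have hEt : E.fill t = Fill.plus := by simp [hE, setFill]
  have hst : stoneCount D = stoneCount (recolor E) :=
    (stoneCount_flip (D := D) (E := E) rfl hp ht hfill hpf htf hEp hEt).trans
      (stoneCount_recolor E).symm
  have hblack : countFill D Fill.black = countFill (recolor E) Fill.black := by
    rw [countFill_black_of_blackIffUncross hB, countFill_black_recolor]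
    exact uncrossCount_flip (D := D) (E := E) rfl hp ht hfill hpf htf hEp hEt hpair
  have hw := stoneCount_eq_black_add_white D
  have hw' := stoneCount_eq_black_add_white (recolor E)
  have hplus := stoneCount_add_plus D
  have hplus' : stoneCount (recolor E) + countFill (recolor E) Fill.plus = D.S.boxes.card :=
    stoneCount_add_plus (recolor E)
  have hc : ∀ f, countFill D' f = countFill (recolor E) f := countFill_congr hD'
  rw [hc, hc, hc]
  refine ⟨hblack, ?_, ?_⟩ <;> omega

end GoPaper
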